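/- Assume U(Σ^{-1}) is positive definite and L(Σ^{-1}) + S(Σ^{-1}) U(Σ^{-1})^{-1} S(Σ^{-1})ᵀ ≤ 0. Then U₁(Σ₁^{-1}) is positive definite and L₁₁(Σ₁^{-1}) + S₁(Σ₁^{-1}) U₁(Σ₁^{-1})^{-1} S₁(Σ₁^{-1})ᵀ ≤ 0. That is, the truncated matrix Σ₁ is a reachability Gramian of the balanced reduced system. -/

import Mathlib

open Matrix

/-- The operator `L(X) = AᵀX + XA + Σ_{i,j} k_{ij} N_iᵀ X N_j` (general index type). -/
noncomputable def Lop {ι : Type*} [Fintype ι] {q : ℕ} (A : Matrix ι ι ℝ)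
    (N : Fin q → Matrix ι ι ℝ) (K : Matrix (Fin q) (Fin q) ℝ)
    (X : Matrix ι ι ℝ) : Matrix ι ι ℝ :=
  Aᵀ * X + X * A + ∑ i, ∑ j, K i j • ((N i)ᵀ * X * N j)

/-- The operator `S(X) = XB + Σ_{i,j} k_{ij} N_iᵀ X M_j` (general index type). -/
noncomputable def Sop {ι : Type*} [Fintype ι] {m q : ℕ} (B : Matrix ι (Fin m) ℝ)
    (N : Fin q → Matrix ι ι ℝ) (M : Fin q → Matrix ι (Fin m) ℝ)
    (K : Matrix (Fin q) (Fin q) ℝ) (X : Matrix ι ι ℝ) : Matrix ι (Fin m) ℝ :=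
  X * B + ∑ i, ∑ j, K i j • ((N i)ᵀ * X * M j)

/-- The operator `U(X) = γ I_m − Σ_{i,j} k_{ij} M_iᵀ X M_j` (general index type). -/
noncomputable def Uop {ι : Type*} [Fintype ι] {m q : ℕ} (γ : ℝ)
    (M : Fin q → Matrix ι (Fin m) ℝ)
    (K : Matrix (Fin q) (Fin q) ℝ) (X : Matrix ι ι ℝ) : Matrix (Fin m) (Fin m) ℝ :=
  γ • (1 : Matrix (Fin m) (Fin m) ℝ) - ∑ i, ∑ j, K i j • ((M i)ᵀ * X * M j)

/-- A weighted sum `∑ i, ∑ j, K i j • (P i)ᵀ D (P j)` with `K` positive semidefinite and `D` a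
nonnegative diagonal matrix is positive semidefinite. -/
theorem posSemidef_sum_smul_transpose_mul_diagonal_mul {ι κ τ : Type*} [Fintype ι] [DecidableEq ι]
    [Fintype κ] [Fintype τ] {K : Matrix τ τ ℝ} (hK : K.PosSemidef) {d : ι → ℝ}
    (hd : ∀ l, 0 ≤ d l) (P : τ → Matrix ι κ ℝ) :
    (∑ i, ∑ j, K i j • ((P i)ᵀ * diagonal d * P j)).PosSemidef := by
  have h : ∑ i, ∑ j, K i j • ((P i)ᵀ * diagonal d * P j) =
      ∑ l, d l • ((of fun i k => P i l k)ᴴ * K * (of fun i k => P i l k)) := by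
    ext a b
    have hP (i j : τ) : ((P i)ᵀ * diagonal d * P j) a b = ∑ l, P i l a * d l * P j l b := by
      rw [mul_apply]
      simp only [mul_diagonal, transpose_apply]
    simp only [Matrix.sum_apply, Matrix.smul_apply, hP]
    simp only [mul_apply, conjTranspose_apply, of_apply, smul_eq_mul, star_trivial,
      Finset.mul_sum, Finset.sum_mul]
    rw [Finset.sum_comm]
    conv_rhs => rw [Finset.sum_comm]
    refine Finset.sum_congr rfl fun j _ => ?_
    rw [Finset.sum_comm]
    refine Finset.sum_congr rfl fun l _ => Finset.sum_congr rfl fun i _ => ?_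
    ring
  rw [h]
  exact posSemidef_sum _ fun l _ => (hK.conjTranspose_mul_mul_same _).smul (hd l)

theorem diagonal_inv_of_pos {ι : Type*} [Fintype ι] [DecidableEq ι] {σ : ι → ℝ}
    (hσ : ∀ i, 0 < σ i) : (diagonal σ)⁻¹ = diagonal fun i => (σ i)⁻¹ := by
  refine inv_eq_right_inv ?_
  rw [diagonal_mul_diagonal, ← diagonal_one]
  exact congrArg diagonal (funext fun i => mul_inv_cancel₀ (hσ i).ne')

/-- Schur complement criterion for the Riccati-type inequality `L + S U⁻¹ Sᵀ ≤ 0`. -/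
theorem posSemidef_neg_add_mul_inv_mul_transpose_iff {ι κ : Type*} [Fintype ι] [Fintype κ]
    [DecidableEq κ] (L : Matrix ι ι ℝ) (S : Matrix ι κ ℝ) {U : Matrix κ κ ℝ} (hU : U.PosDef) :
    (-(L + S * U⁻¹ * Sᵀ)).PosSemidef ↔ (fromBlocks (-L) (-S) (-S)ᵀ U).PosSemidef := by
  have := hU.isUnit.invertible
  have h := hU.fromBlocks₂₂ (-L) (-S)
  rw [conjTranspose_eq_transpose_of_trivial] at h
  rw [h]
  simp [sub_eq_add_neg, add_comm]

/-- Decomposition of the `L` operator at a block diagonal argument. -/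
theorem toBlocks₁₁_Lop {ι κ : Type*} [Fintype ι] [Fintype κ] {q : ℕ}
    (A11 : Matrix ι ι ℝ) (A12 : Matrix ι κ ℝ) (A21 : Matrix κ ι ℝ) (A22 : Matrix κ κ ℝ)
    (N11 : Fin q → Matrix ι ι ℝ) (N12 : Fin q → Matrix ι κ ℝ)
    (N21 : Fin q → Matrix κ ι ℝ) (N22 : Fin q → Matrix κ κ ℝ)
    (K : Matrix (Fin q) (Fin q) ℝ) (X : Matrix ι ι ℝ) (Y : Matrix κ κ ℝ) :
    (Lop (fromBlocks A11 A12 A21 A22)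
      (fun i => fromBlocks (N11 i) (N12 i) (N21 i) (N22 i)) K (fromBlocks X 0 0 Y)).toBlocks₁₁ =
      Lop A11 N11 K X + ∑ i, ∑ j, K i j • ((N21 i)ᵀ * Y * N21 j) := by
  ext a b
  simp [Lop, toBlocks₁₁, fromBlocks_transpose, fromBlocks_multiply, Matrix.sum_apply, mul_add,
    Finset.sum_add_distrib, add_assoc]

/-- Decomposition of the `S` operator at a block diagonal argument. -/
theorem toRows₁_Sop {ι κ : Type*} [Fintype ι] [Fintype κ] {m q : ℕ}
    (B1 : Matrix ι (Fin m) ℝ) (B2 : Matrix κ (Fin m) ℝ)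
    (N11 : Fin q → Matrix ι ι ℝ) (N12 : Fin q → Matrix ι κ ℝ)
    (N21 : Fin q → Matrix κ ι ℝ) (N22 : Fin q → Matrix κ κ ℝ)
    (M1 : Fin q → Matrix ι (Fin m) ℝ) (M2 : Fin q → Matrix κ (Fin m) ℝ)
    (K : Matrix (Fin q) (Fin q) ℝ) (X : Matrix ι ι ℝ) (Y : Matrix κ κ ℝ) :
    (Sop (fromRows B1 B2) (fun i => fromBlocks (N11 i) (N12 i) (N21 i) (N22 i))
      (fun i => fromRows (M1 i) (M2 i)) K (fromBlocks X 0 0 Y)).toRows₁ =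
      Sop B1 N11 M1 K X + ∑ i, ∑ j, K i j • ((N21 i)ᵀ * Y * M2 j) := by
  ext a b
  simp [Sop, toRows₁, fromBlocks_transpose, fromBlocks_multiply, fromBlocks_mul_fromRows,
    Matrix.sum_apply, mul_add, Finset.sum_add_distrib, add_assoc]

/-- Decomposition of the `U` operator at a block diagonal argument. -/
theorem Uop_fromRows {ι κ : Type*} [Fintype ι] [Fintype κ] {m q : ℕ} (γ : ℝ)
    (M1 : Fin q → Matrix ι (Fin m) ℝ) (M2 : Fin q → Matrix κ (Fin m) ℝ)
    (K : Matrix (Fin q) (Fin q) ℝ) (X : Matrix ι ι ℝ) (Y : Matrix κ κ ℝ) :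
    Uop γ (fun i => fromRows (M1 i) (M2 i)) K (fromBlocks X 0 0 Y) =
      Uop γ M1 K X - ∑ i, ∑ j, K i j • ((M2 i)ᵀ * Y * M2 j) := by
  simp [Uop, transpose_fromRows, fromCols_mul_fromBlocks, fromCols_mul_fromRows, smul_add,
    Finset.sum_add_distrib, sub_sub]

/-- If the balanced Gramian `Σ = diag(Σ₁, Σ₂)` satisfies `U(Σ⁻¹) > 0` and
`L(Σ⁻¹) + S(Σ⁻¹) U(Σ⁻¹)⁻¹ S(Σ⁻¹)ᵀ ≤ 0`, then the truncated matrix `Σ₁` satisfies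
`U₁(Σ₁⁻¹) > 0` and `L₁₁(Σ₁⁻¹) + S₁(Σ₁⁻¹) U₁(Σ₁⁻¹)⁻¹ S₁(Σ₁⁻¹)ᵀ ≤ 0`, i.e. `Σ₁` is a
reachability Gramian of the balanced reduced system.  The full coefficients are given in
block form, e.g. `A = [[A₁₁, A₁₂],[A₂₁, A₂₂]]`. -/
theorem reduced_reachability_gramian {r s m q : ℕ} [NeZero r] [NeZero s] [NeZero m] [NeZero q]
    (A11 : Matrix (Fin r) (Fin r) ℝ) (A12 : Matrix (Fin r) (Fin s) ℝ)
    (A21 : Matrix (Fin s) (Fin r) ℝ) (A22 : Matrix (Fin s) (Fin s) ℝ)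
    (B1 : Matrix (Fin r) (Fin m) ℝ) (B2 : Matrix (Fin s) (Fin m) ℝ)
    (N11 : Fin q → Matrix (Fin r) (Fin r) ℝ) (N12 : Fin q → Matrix (Fin r) (Fin s) ℝ)
    (N21 : Fin q → Matrix (Fin s) (Fin r) ℝ) (N22 : Fin q → Matrix (Fin s) (Fin s) ℝ)
    (M1 : Fin q → Matrix (Fin r) (Fin m) ℝ) (M2 : Fin q → Matrix (Fin s) (Fin m) ℝ)
    (K : Matrix (Fin q) (Fin q) ℝ) (hK : K.PosSemidef)
    (γ : ℝ) (hγ : 0 < γ)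
    (σ1 : Fin r → ℝ) (σ2 : Fin s → ℝ) (hσ1 : ∀ i, 0 < σ1 i) (hσ2 : ∀ i, 0 < σ2 i)
    (hU : (Uop γ (fun i => fromRows (M1 i) (M2 i)) K
        (diagonal (Sum.elim σ1 σ2))⁻¹).PosDef)
    (hIneq : (-(Lop (fromBlocks A11 A12 A21 A22)
          (fun i => fromBlocks (N11 i) (N12 i) (N21 i) (N22 i)) K
          (diagonal (Sum.elim σ1 σ2))⁻¹ +
        Sop (fromRows B1 B2) (fun i => fromBlocks (N11 i) (N12 i) (N21 i) (N22 i))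
            (fun i => fromRows (M1 i) (M2 i)) K (diagonal (Sum.elim σ1 σ2))⁻¹ *
          (Uop γ (fun i => fromRows (M1 i) (M2 i)) K (diagonal (Sum.elim σ1 σ2))⁻¹)⁻¹ *
          (Sop (fromRows B1 B2) (fun i => fromBlocks (N11 i) (N12 i) (N21 i) (N22 i))
            (fun i => fromRows (M1 i) (M2 i)) K
            (diagonal (Sum.elim σ1 σ2))⁻¹)ᵀ)).PosSemidef) :
    (Uop γ M1 K (diagonal σ1)⁻¹).PosDef ∧
    (-(Lop A11 N11 K (diagonal σ1)⁻¹ +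
        Sop B1 N11 M1 K (diagonal σ1)⁻¹ * (Uop γ M1 K (diagonal σ1)⁻¹)⁻¹ *
          (Sop B1 N11 M1 K (diagonal σ1)⁻¹)ᵀ)).PosSemidef := by
  have hd : ∀ i, 0 ≤ (σ2 i)⁻¹ := fun i => (inv_pos.mpr (hσ2 i)).le
  have hdiag : (diagonal (Sum.elim σ1 σ2))⁻¹ =
      fromBlocks (diagonal σ1)⁻¹ 0 0 (diagonal fun i => (σ2 i)⁻¹) := by
    rw [diagonal_inv_of_pos (Sum.rec hσ1 hσ2), diagonal_inv_of_pos hσ1, fromBlocks_diagonal]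
    congr 1
    ext (i | i) <;> rfl
  have hU1 : (Uop γ M1 K (diagonal σ1)⁻¹).PosDef := by
    rw [hdiag, Uop_fromRows] at hU
    simpa using hU.add_posSemidef (posSemidef_sum_smul_transpose_mul_diagonal_mul hK hd M2)
  refine ⟨hU1, ?_⟩
  rw [posSemidef_neg_add_mul_inv_mul_transpose_iff _ _ hU, hdiag] at hIneq
  rw [posSemidef_neg_add_mul_inv_mul_transpose_iff _ _ hU1]
  have hsub := (hIneq.submatrix (Sum.map Sum.inl id)).add
    (posSemidef_sum_smul_transpose_mul_diagonal_mul hK hd fun i => fromCols (N21 i) (M2 i))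
  have hL := toBlocks₁₁_Lop A11 A12 A21 A22 N11 N12 N21 N22 K (diagonal σ1)⁻¹
    (diagonal fun i => (σ2 i)⁻¹)
  have hS := toRows₁_Sop B1 B2 N11 N12 N21 N22 M1 M2 K (diagonal σ1)⁻¹
    (diagonal fun i => (σ2 i)⁻¹)
  have hU' := Uop_fromRows γ M1 M2 K (diagonal σ1)⁻¹ (diagonal fun i => (σ2 i)⁻¹)
  have hT : ∑ i, ∑ j, K i j • ((M2 i)ᵀ * (diagonal fun i => (σ2 i)⁻¹) * N21 j) =
      (∑ i, ∑ j, K i j • ((N21 i)ᵀ * (diagonal fun i => (σ2 i)⁻¹) * M2 j))ᵀ := by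
    simp only [transpose_sum, transpose_smul, transpose_mul, diagonal_transpose,
      transpose_transpose]
    rw [Finset.sum_comm]
    refine Finset.sum_congr rfl fun i _ => Finset.sum_congr rfl fun j _ => ?_
    rw [← hK.isHermitian.apply, star_trivial, Matrix.mul_assoc]
  convert hsub using 1
  ext (a | a) (b | b)
  · have := congrFun (congrFun hL a) b
    simp [toBlocks₁₁, Matrix.sum_apply] at this
    simp [Matrix.sum_apply, transpose_fromCols, fromRows_mul, this]
  · have := congrFun (congrFun hS a) b
    simp [toRows₁, Matrix.sum_apply] at this
    simp [Matrix.sum_apply, transpose_fromCols, fromRows_mul, this]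
  · have := congrFun (congrFun hS b) a
    have ht := congrFun (congrFun hT a) b
    simp [toRows₁, Matrix.sum_apply] at this ht
    simp [Matrix.sum_apply, transpose_fromCols, fromRows_mul, this, ht]
  · rw [hU']
    simp [Matrix.sum_apply, transpose_fromCols, fromRows_mul]
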